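/- For every nonnegative integer n, a̅₅(10n+9) = 2·c₅(10n+8). -/

import Mathlib

open scoped BigOperators

/-- The q-Pochhammer infinite product `(a; q)_∞ = ∏_{k≥0} (1 - a q^k)`. -/
noncomputable def qpoch (a q : ℂ) : ℂ := ∏' k : ℕ, (1 - a * q ^ k)

/-- `φ(-q) = (q;q)_∞² / (q²;q²)_∞`. -/
noncomputable def phiNeg (q : ℂ) : ℂ := qpoch q q ^ 2 / qpoch (q ^ 2) (q ^ 2)

/-- `ψ(-q) = (q;q)_∞ (q⁴;q⁴)_∞ / (q²;q²)_∞`. -/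
noncomputable def psiNeg (q : ℂ) : ℂ :=
  qpoch q q * qpoch (q ^ 4) (q ^ 4) / qpoch (q ^ 2) (q ^ 2)


/-! ## Basic facts on the infinite products -/

theorem qp_summable (a : ℂ) {q : ℂ} (hq : ‖q‖ < 1) : Summable fun k : ℕ => ‖-(a * q ^ k)‖ := by
  simp only [norm_neg, norm_mul, norm_pow]
  exact (summable_geometric_of_lt_one (norm_nonneg _) hq).mul_left _

theorem qp_mult (a : ℂ) {q : ℂ} (hq : ‖q‖ < 1) : Multipliable fun k : ℕ => 1 - a * q ^ k := by
  have := multipliable_one_add_of_summable (qp_summable a hq)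
  simpa [sub_eq_add_neg] using this

theorem qp_tendsto (a : ℂ) {q : ℂ} (hq : ‖q‖ < 1) :
    Filter.Tendsto (fun n : ℕ => ∏ k ∈ Finset.range n, (1 - a * q ^ k)) Filter.atTop
      (nhds (qpoch a q)) :=
  (qp_mult a hq).hasProd.tendsto_prod_nat

theorem qp_ne_zero {a q : ℂ} (hq : ‖q‖ < 1) (h : ∀ k : ℕ, a * q ^ k ≠ 1) : qpoch a q ≠ 0 := by
  have := tprod_one_add_ne_zero_of_summable (f := fun k : ℕ => -(a * q ^ k))
    (fun k hk => h k (by linear_combination -hk)) (qp_summable a hq)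
  simpa [qpoch, sub_eq_add_neg] using this

theorem qp_ne_zero' {a q : ℂ} (hq : ‖q‖ < 1) (ha : ‖a‖ < 1) : qpoch a q ≠ 0 := by
  apply qp_ne_zero hq
  intro k hk
  have h1 : ‖a * q ^ k‖ < 1 := by
    rw [norm_mul, norm_pow]
    calc ‖a‖ * ‖q‖ ^ k ≤ ‖a‖ * 1 :=
          mul_le_mul_of_nonneg_left (pow_le_one₀ (norm_nonneg _) hq.le) (norm_nonneg _)
      _ < 1 := by simpa using ha
  rw [hk] at h1
  simp at h1

theorem pow_norm_lt {q : ℂ} (hq : ‖q‖ < 1) {m : ℕ} (hm : m ≠ 0) : ‖q ^ m‖ < 1 := by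
  rw [norm_pow]
  exact pow_lt_one₀ (norm_nonneg _) hq hm

theorem qp_split (a : ℂ) {q : ℂ} (hq : ‖q‖ < 1) {m : ℕ} (hm : m ≠ 0) :
    qpoch a q = ∏ r ∈ Finset.range m, qpoch (a * q ^ r) (q ^ m) := by
  have h1 : Filter.Tendsto (fun n : ℕ => ∏ k ∈ Finset.range (m * n), (1 - a * q ^ k)) Filter.atTop
      (nhds (qpoch a q)) :=
    (qp_tendsto a hq).comp (Filter.tendsto_id.const_mul_atTop' (Nat.pos_of_ne_zero hm))
  have h2 : Filter.Tendsto (fun n : ℕ => ∏ r ∈ Finset.range m, ∏ k ∈ Finset.range n,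
      (1 - (a * q ^ r) * (q ^ m) ^ k)) Filter.atTop
      (nhds (∏ r ∈ Finset.range m, qpoch (a * q ^ r) (q ^ m))) :=
    tendsto_finsetProd _ fun r _ => qp_tendsto _ (pow_norm_lt hq hm)
  refine tendsto_nhds_unique h1 (h2.congr fun n => ?_)
  rw [Finset.prod_comm]
  induction n with
  | zero => simp
  | succ n ih =>
    rw [Finset.prod_range_succ, ih, Nat.mul_succ, Finset.prod_range_add]
    congr 1
    refine Finset.prod_congr rfl fun r _ => ?_
    ring

theorem qp_shift (a : ℂ) {q : ℂ} (hq : ‖q‖ < 1) : qpoch a q = (1 - a) * qpoch (a * q) q := by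
  have h1 := (qp_tendsto a hq).comp (Filter.tendsto_add_atTop_nat 1)
  refine tendsto_nhds_unique h1 (((qp_tendsto (a * q) hq).const_mul (1 - a)).congr fun n => ?_)
  simp only [Function.comp, Finset.prod_range_succ']
  rw [mul_comm]
  simp [pow_succ', mul_assoc]

theorem qp_neg (a : ℂ) {q : ℂ} (hq : ‖q‖ < 1) :
    qpoch a q * qpoch (-a) q = qpoch (a ^ 2) (q ^ 2) := by
  unfold qpoch
  rw [← (qp_mult a hq).tprod_mul (qp_mult (-a) hq)]
  exact tprod_congr fun k => by ring

theorem qp_five (a z : ℂ) (hz : z ^ 4 + z ^ 3 + z ^ 2 + z + 1 = 0) {q : ℂ} (hq : ‖q‖ < 1) :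
    qpoch a q * qpoch (z * a) q * qpoch (z ^ 2 * a) q * qpoch (z ^ 3 * a) q * qpoch (z ^ 4 * a) q
      = qpoch (a ^ 5) (q ^ 5) := by
  unfold qpoch
  rw [← (qp_mult a hq).tprod_mul (qp_mult _ hq),
    ← ((qp_mult a hq).mul (qp_mult _ hq)).tprod_mul (qp_mult _ hq),
    ← (((qp_mult a hq).mul (qp_mult _ hq)).mul (qp_mult _ hq)).tprod_mul (qp_mult _ hq),
    ← ((((qp_mult a hq).mul (qp_mult _ hq)).mul (qp_mult _ hq)).mul (qp_mult _ hq)).tprod_mul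
      (qp_mult _ hq)]
  refine tprod_congr fun k => ?_
  have key : ∀ u : ℂ, (1 - u) * (1 - z * u) * (1 - z ^ 2 * u) * (1 - z ^ 3 * u) * (1 - z ^ 4 * u)
      = 1 - u ^ 5 := by
    intro u
    have h5 : z ^ 5 = 1 := by linear_combination (z - 1) * hz
    have h6 : z ^ 6 = z := by linear_combination z * h5
    have h7 : z ^ 7 = z ^ 2 := by linear_combination z ^ 2 * h5
    have h8 : z ^ 8 = z ^ 3 := by linear_combination z ^ 3 * h5
    have h9 : z ^ 9 = z ^ 4 := by linear_combination z ^ 4 * h5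
    have h10 : z ^ 10 = 1 := by linear_combination (z ^ 5 + 1) * h5
    ring_nf
    rw [h10, h9, h8, h7, h6, h5]
    linear_combination (-u + 2 * u ^ 2 - 2 * u ^ 3 + u ^ 4) * hz
  have := key (a * q ^ k)
  rw [show (a ^ 5 * (q ^ 5) ^ k) = (a * q ^ k) ^ 5 by ring, ← this]
  ring

/-! ## The Jacobi triple product identity -/

/-- The finite product `(q;q)_n`. -/
noncomputable def fpoch (q : ℂ) (n : ℕ) : ℂ := ∏ k ∈ Finset.range n, (1 - q * q ^ k)

theorem fpoch_succ (q : ℂ) (n : ℕ) : fpoch q (n + 1) = fpoch q n * (1 - q ^ (n + 1)) := by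
  rw [fpoch, Finset.prod_range_succ, pow_succ']; rfl

theorem one_sub_pow_ne {q : ℂ} (hq : ‖q‖ < 1) (n : ℕ) : 1 - q ^ (n + 1) ≠ 0 := by
  intro h
  have h1 := pow_norm_lt hq (Nat.succ_ne_zero n)
  rw [show q ^ (n + 1) = 1 by linear_combination -h] at h1
  simp at h1

theorem fpoch_ne {q : ℂ} (hq : ‖q‖ < 1) (n : ℕ) : fpoch q n ≠ 0 := by
  refine Finset.prod_ne_zero_iff.2 fun k _ => ?_
  rw [← pow_succ']
  exact one_sub_pow_ne hq k

/-- Gaussian binomial coefficients, as a quotient of products. -/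
noncomputable def gbin (q : ℂ) (M j : ℕ) : ℂ :=
  if j ≤ M then fpoch q M / (fpoch q j * fpoch q (M - j)) else 0

theorem gbin_zero {q : ℂ} (hq : ‖q‖ < 1) (M : ℕ) : gbin q M 0 = 1 := by
  have := fpoch_ne hq M
  have h0 : fpoch q 0 = 1 := by simp [fpoch]
  simp [gbin, h0, this]

theorem gbin_succ {q : ℂ} (hq : ‖q‖ < 1) (M j : ℕ) (hj : j ≤ M) :
    gbin q (M + 1) (j + 1) = gbin q M (j + 1) + q ^ (M - j) * gbin q M j := by
  obtain ⟨d, rfl⟩ := Nat.exists_eq_add_of_le hj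
  have h1 := fpoch_ne hq j
  have h2 := fpoch_ne hq d
  have h3 := one_sub_pow_ne hq j
  rcases d with _ | d
  · have h4 := one_sub_pow_ne hq j
    simp [gbin, fpoch_succ]
    field_simp
  · have h4 := one_sub_pow_ne hq d
    have h5 := fpoch_ne hq d
    have e1 : j + (d + 1) + 1 - (j + 1) = d + 1 := by omega
    have e2 : j + (d + 1) - (j + 1) = d := by omega
    have e3 : j + (d + 1) - j = d + 1 := by omega
    have e4 : j + 1 ≤ j + (d + 1) := by omega
    have e5 : j + 1 ≤ j + (d + 1) + 1 := by omega
    have e6 : j ≤ j + (d + 1) := by omega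
    simp only [gbin, e1, e2, e3, e4, e5, e6, if_true, fpoch_succ q (j + (d + 1)), fpoch_succ q j,
      fpoch_succ q d]
    field_simp
    ring

theorem cauchy_binom {s : ℂ} (hs : ‖s ^ 2‖ < 1) (w : ℂ) (M : ℕ) :
    ∏ k ∈ Finset.range M, (1 + w * s ^ (2 * k + 1)) =
      ∑ j ∈ Finset.range (M + 1), gbin (s ^ 2) M j * s ^ (j ^ 2) * w ^ j := by
  induction M with
  | zero => simp [gbin, fpoch]
  | succ M ih =>
    rw [Finset.prod_range_succ, ih, Finset.sum_range_succ' _ (M + 1), gbin_zero hs]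
    have h1 : ∑ j ∈ Finset.range (M + 1), gbin (s ^ 2) (M + 1) (j + 1) * s ^ ((j + 1) ^ 2) *
        w ^ (j + 1) = ∑ j ∈ Finset.range (M + 1), (gbin (s ^ 2) M (j + 1) * s ^ ((j + 1) ^ 2) *
        w ^ (j + 1) + w * s ^ (2 * M + 1) * (gbin (s ^ 2) M j * s ^ (j ^ 2) * w ^ j)) := by
      refine Finset.sum_congr rfl fun j hj => ?_
      have hj' : j ≤ M := by simpa [Nat.lt_succ_iff] using hj
      rw [gbin_succ hs M j hj']
      obtain ⟨d, rfl⟩ := Nat.exists_eq_add_of_le hj'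
      rw [Nat.add_sub_cancel_left]
      ring
    have h2 := Finset.sum_range_succ' (fun j => gbin (s ^ 2) M j * s ^ (j ^ 2) * w ^ j) (M + 1)
    rw [Finset.sum_range_succ] at h2
    have h3 : gbin (s ^ 2) M (M + 1) = 0 := by simp [gbin]
    rw [h3, gbin_zero hs] at h2
    rw [h1, Finset.sum_add_distrib, ← Finset.mul_sum]
    simp only [zero_mul, add_zero] at h2
    rw [mul_add, mul_one, mul_comm _ (w * s ^ (2 * M + 1))]
    nth_rewrite 1 [h2]
    ring

theorem prod_pow_odd (s : ℂ) (N : ℕ) : ∏ i ∈ Finset.range N, s ^ (2 * i + 1) = s ^ (N ^ 2) := by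
  induction N with
  | zero => simp
  | succ N ih => rw [Finset.prod_range_succ, ih, ← pow_add]; ring

theorem finite_jtp {s v : ℂ} (hs0 : s ≠ 0) (hs : ‖s ^ 2‖ < 1) (hv : v ≠ 0) (N : ℕ) :
    (∏ i ∈ Finset.range N, (1 + v * s ^ (2 * i + 1))) *
      (∏ i ∈ Finset.range N, (1 + v⁻¹ * s ^ (2 * i + 1))) =
    ∑ j ∈ Finset.range (2 * N + 1), gbin (s ^ 2) (2 * N) j *
      (v ^ ((j : ℤ) - N) * s ^ (((j : ℤ) - N) ^ 2)) := by
  have h := cauchy_binom hs (v * (s ^ (2 * N))⁻¹) (2 * N)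
  have hpow : ∀ n : ℕ, s ^ n ≠ 0 := fun n => pow_ne_zero _ hs0
  rw [two_mul N, Finset.prod_range_add, ← two_mul, ← Finset.prod_range_reflect] at h
  have h1 : ∏ j ∈ Finset.range N, (1 + v * (s ^ (2 * N))⁻¹ * s ^ (2 * (N - 1 - j) + 1)) =
      v ^ N * (s ^ (N ^ 2))⁻¹ * ∏ i ∈ Finset.range N, (1 + v⁻¹ * s ^ (2 * i + 1)) := by
    rw [← prod_pow_odd, ← Finset.prod_inv_distrib, ← Finset.card_range N, ← Finset.prod_const,
      Finset.card_range, ← Finset.prod_mul_distrib, ← Finset.prod_mul_distrib]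
    refine Finset.prod_congr rfl fun j hj => ?_
    have hj' : j < N := by simpa using hj
    obtain ⟨d, rfl⟩ := Nat.exists_eq_add_of_lt hj'
    rw [show j + d + 1 - 1 - j = d by omega]
    have e : s ^ (2 * (j + d + 1)) = s ^ (2 * j + 1) * s ^ (2 * d + 1) := by ring
    rw [e]
    have := hpow (2 * j + 1)
    have := hpow (2 * d + 1)
    field_simp
    ring
  have h2 : ∏ j ∈ Finset.range N, (1 + v * (s ^ (2 * N))⁻¹ * s ^ (2 * (N + j) + 1)) =
      ∏ i ∈ Finset.range N, (1 + v * s ^ (2 * i + 1)) := by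
    refine Finset.prod_congr rfl fun j hj => ?_
    have := hpow (2 * N)
    rw [show 2 * (N + j) + 1 = 2 * N + (2 * j + 1) by ring, pow_add]
    field_simp
  rw [h1, h2] at h
  have h3 : v ^ N * (s ^ (N ^ 2))⁻¹ ≠ 0 :=
    mul_ne_zero (pow_ne_zero _ hv) (inv_ne_zero (hpow _))
  apply mul_left_cancel₀ h3
  rw [mul_comm (∏ i ∈ Finset.range N, (1 + v * s ^ (2 * i + 1))), ← mul_assoc, h, Finset.mul_sum]
  refine Finset.sum_congr rfl fun j hj => ?_
  have e1 : v ^ ((j : ℤ) - N) = v ^ j * (v ^ N)⁻¹ := by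
    rw [zpow_sub₀ hv]; simp [div_eq_mul_inv]
  have e2 : s ^ (((j : ℤ) - N) ^ 2) = s ^ (j ^ 2) * s ^ (N ^ 2) * ((s ^ (2 * N)) ^ j)⁻¹ := by
    rw [show ((j : ℤ) - N) ^ 2 = (((j ^ 2 + N ^ 2 : ℕ) : ℤ)) - ((2 * N * j : ℕ) : ℤ) by
      push_cast; ring, zpow_sub₀ hs0, zpow_natCast, zpow_natCast, pow_add, div_eq_mul_inv, pow_mul]
  rw [e1, e2, mul_pow, inv_pow]
  have := pow_ne_zero N hv
  have := hpow (N ^ 2)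
  field_simp

/-- Summability of the bilateral theta series. -/
theorem theta_summable_norm {s : ℂ} (hs0 : s ≠ 0) (hs : ‖s‖ < 1) {v : ℂ} (hv : v ≠ 0) :
    Summable fun n : ℤ => ‖v ^ n * s ^ (n ^ 2)‖ := by
  have key : ∀ u : ℂ, u ≠ 0 → Summable fun n : ℕ => ‖u ^ n * s ^ (n ^ 2)‖ := by
    intro u hu
    have hne : ∀ n : ℕ, u ^ n * s ^ (n ^ 2) ≠ 0 := fun n =>
      mul_ne_zero (pow_ne_zero _ hu) (pow_ne_zero _ hs0)
    have hs2 := summable_of_ratio_test_tendsto_lt_one (f := fun n : ℕ => u ^ n * s ^ (n ^ 2))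
      (l := 0) one_pos (Filter.Eventually.of_forall hne) ?_
    · exact hs2.norm
    · have h1 : Filter.Tendsto (fun n : ℕ => ‖u‖ * ‖s‖ * (‖s‖ ^ 2) ^ n) Filter.atTop
          (nhds (‖u‖ * ‖s‖ * 0)) :=
        (tendsto_pow_atTop_nhds_zero_of_lt_one (by positivity)
          (pow_lt_one₀ (norm_nonneg _) hs two_ne_zero)).const_mul _
      rw [mul_zero] at h1
      refine h1.congr fun n => ?_
      rw [← norm_div, show u ^ (n + 1) * s ^ ((n + 1) ^ 2) / (u ^ n * s ^ (n ^ 2)) =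
        u * s * (s ^ 2) ^ n by
          rw [div_eq_iff (hne n)]; ring]
      simp
  apply Summable.of_nat_of_neg
  · refine (key v hv).congr fun n => ?_
    rw [zpow_natCast, show ((n : ℤ) ^ 2) = ((n ^ 2 : ℕ) : ℤ) by push_cast; ring, zpow_natCast]
  · refine (key v⁻¹ (inv_ne_zero hv)).congr fun n => ?_
    rw [zpow_neg, zpow_natCast, show ((-(n : ℤ)) ^ 2) = ((n ^ 2 : ℕ) : ℤ) by push_cast; ring,
      zpow_natCast, inv_pow]

/-- The bilateral theta series. -/
noncomputable def Th (v s : ℂ) : ℂ := ∑' n : ℤ, v ^ n * s ^ (n ^ 2)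

theorem jtp {s v : ℂ} (hs0 : s ≠ 0) (hs : ‖s‖ < 1) (hv : v ≠ 0) :
    Th v s = qpoch (s ^ 2) (s ^ 2) * qpoch (-(v * s)) (s ^ 2) * qpoch (-(v⁻¹ * s)) (s ^ 2) := by
  have hs2 : ‖s ^ 2‖ < 1 := pow_norm_lt hs two_ne_zero
  set E := qpoch (s ^ 2) (s ^ 2) with hE
  have hE0 : E ≠ 0 := qp_ne_zero' hs2 hs2
  have hP : Filter.Tendsto (fpoch (s ^ 2)) Filter.atTop (nhds E) := qp_tendsto _ hs2
  have hPi : Filter.Tendsto (fun n => (fpoch (s ^ 2) n)⁻¹) Filter.atTop (nhds E⁻¹) := hP.inv₀ hE0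
  obtain ⟨C1, hC1⟩ := hP.norm.bddAbove_range
  obtain ⟨C2, hC2⟩ := hPi.norm.bddAbove_range
  have hC1' : ∀ n, ‖fpoch (s ^ 2) n‖ ≤ C1 := fun n => hC1 ⟨n, rfl⟩
  have hC2' : ∀ n, ‖(fpoch (s ^ 2) n)⁻¹‖ ≤ C2 := fun n => hC2 ⟨n, rfl⟩
  have hC10 : 0 ≤ C1 := (norm_nonneg _).trans (hC1' 0)
  have hC20 : 0 ≤ C2 := (norm_nonneg _).trans (hC2' 0)
  let F : ℕ → ℤ → ℂ := fun N n =>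
    if 0 ≤ n + N then gbin (s ^ 2) (2 * N) (n + N).toNat * (v ^ n * s ^ (n ^ 2)) else 0
  have hF : ∀ N, ∑' n, F N n = (∏ i ∈ Finset.range N, (1 + v * s ^ (2 * i + 1))) *
      (∏ i ∈ Finset.range N, (1 + v⁻¹ * s ^ (2 * i + 1))) := by
    intro N
    have hinj : Set.InjOn (fun j : ℕ => (j : ℤ) - N) (Finset.range (2 * N + 1)) := by
      intro x _ y _ h
      simpa using h
    rw [finite_jtp hs0 hs2 hv,
      tsum_eq_sum (s := (Finset.range (2 * N + 1)).image fun j : ℕ => (j : ℤ) - N),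
      Finset.sum_image hinj]
    · refine Finset.sum_congr rfl fun j _ => ?_
      simp [F]
    · intro n hn
      simp only [F]
      split_ifs with h
      · have : ¬ (n + N).toNat ≤ 2 * N := by
          intro h'
          apply hn
          simp only [Finset.mem_image, Finset.mem_range]
          exact ⟨(n + N).toNat, by omega, by omega⟩
        simp [gbin, this]
      · rfl
  have hlim : Filter.Tendsto (fun N => ∑' n, F N n) Filter.atTop
      (nhds (∑' n : ℤ, E⁻¹ * (v ^ n * s ^ (n ^ 2)))) := by
    refine tendsto_tsum_of_dominated_convergence
      (bound := fun n : ℤ => C1 * C2 * C2 * ‖v ^ n * s ^ (n ^ 2)‖)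
      ((theta_summable_norm hs0 hs hv).mul_left _) ?_ ?_
    · intro n
      have a1 : Filter.Tendsto (fun N : ℕ => 2 * N) Filter.atTop Filter.atTop :=
        Filter.tendsto_atTop_mono (fun N => by simp only [id]; omega) Filter.tendsto_id
      have a2 : Filter.Tendsto (fun N : ℕ => (n + N).toNat) Filter.atTop Filter.atTop := by
        refine Filter.tendsto_atTop.2 fun b => ?_
        filter_upwards [Filter.eventually_ge_atTop (b + n.natAbs)] with N hN
        omega
      have a3 : Filter.Tendsto (fun N : ℕ => 2 * N - (n + N).toNat) Filter.atTop Filter.atTop := by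
        refine Filter.tendsto_atTop.2 fun b => ?_
        filter_upwards [Filter.eventually_ge_atTop (b + n.natAbs)] with N hN
        omega
      have h1 := (((hP.comp a1).mul ((hPi.comp a2).mul (hPi.comp a3))).mul_const
        (v ^ n * s ^ (n ^ 2)))
      rw [show E * (E⁻¹ * E⁻¹) = E⁻¹ by field_simp] at h1
      refine h1.congr' ?_
      filter_upwards [Filter.eventually_ge_atTop n.natAbs] with N hN
      have b1 : 0 ≤ n + N := by omega
      have b2 : (n + N).toNat ≤ 2 * N := by omega
      simp only [F, b1, b2, gbin, if_true, Function.comp, div_eq_mul_inv, mul_inv]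
    · refine Filter.Eventually.of_forall fun N n => ?_
      have hnn := norm_nonneg (v ^ n * s ^ (n ^ 2))
      have hpos : 0 ≤ C1 * C2 * C2 * ‖v ^ n * s ^ (n ^ 2)‖ := by positivity
      simp only [F]
      split_ifs with h
      · rw [norm_mul]
        refine mul_le_mul_of_nonneg_right ?_ hnn
        unfold gbin
        split_ifs with h'
        · rw [div_eq_mul_inv, mul_inv, norm_mul, norm_mul, mul_assoc]
          gcongr
          · exact hC1' _
          · exact hC2' _
          · exact hC2' _
        · simp; positivity
      · simpa using hpos
  have hlim2 : Filter.Tendsto (fun N => ∑' n, F N n) Filter.atTop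
      (nhds (qpoch (-(v * s)) (s ^ 2) * qpoch (-(v⁻¹ * s)) (s ^ 2))) := by
    refine ((qp_tendsto (-(v * s)) hs2).mul (qp_tendsto (-(v⁻¹ * s)) hs2)).congr fun N => ?_
    rw [hF]
    congr 1 <;> refine Finset.prod_congr rfl fun k _ => ?_ <;> ring
  have := tendsto_nhds_unique hlim hlim2
  rw [tsum_mul_left] at this
  rw [mul_assoc, ← this, Th]
  field_simp

/-! ## Manipulation of theta series -/

theorem Th_summable {s : ℂ} (hs0 : s ≠ 0) (hs : ‖s‖ < 1) {v : ℂ} (hv : v ≠ 0) :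
    Summable fun n : ℤ => v ^ n * s ^ (n ^ 2) :=
  (theta_summable_norm hs0 hs hv).of_norm

theorem Th_inv (v s : ℂ) : Th v⁻¹ s = Th v s := by
  unfold Th
  rw [← (Equiv.neg ℤ).tsum_eq]
  refine tsum_congr fun n => ?_
  simp

theorem Th_shift {s v : ℂ} (hs0 : s ≠ 0) (hv : v ≠ 0) :
    Th (v * s ^ 2) s = v⁻¹ * s⁻¹ * Th v s := by
  unfold Th
  rw [← tsum_mul_left, ← (Equiv.addRight (1 : ℤ)).tsum_eq fun n : ℤ => v⁻¹ * s⁻¹ *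
    (v ^ n * s ^ (n ^ 2))]
  refine tsum_congr fun n => ?_
  simp only [Equiv.coe_addRight]
  rw [show (n + 1) ^ 2 = n ^ 2 + 2 * n + 1 by ring, zpow_add₀ hs0, zpow_add₀ hs0, zpow_add₀ hv,
    zpow_one, zpow_one, mul_zpow, zpow_mul]
  field_simp

theorem Th_shift' {s v w : ℂ} (hs0 : s ≠ 0) (hw : w ≠ 0) (h : v = w * s ^ 2) :
    Th v s = w⁻¹ * s⁻¹ * Th w s := by
  rw [h, Th_shift hs0 hw]

theorem Th_reflect {s v w : ℂ} (hs0 : s ≠ 0) (hw : w ≠ 0) (h : v * w = s ^ 2) :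
    Th v s = w * s⁻¹ * Th w s := by
  rw [Th_shift' hs0 (inv_ne_zero hw) (v := v) (by field_simp; exact h), inv_inv, Th_inv]

theorem Th_dissect {s v : ℂ} (hs0 : s ≠ 0) (hs : ‖s‖ < 1) (hv : v ≠ 0) :
    Th v s = ∑ r : Fin 5, v ^ (r : ℕ) * s ^ ((r : ℕ) ^ 2) *
      Th (v ^ 5 * s ^ (10 * (r : ℕ))) (s ^ 25) := by
  have hS := Th_summable hs0 hs hv
  unfold Th
  rw [← (Int.divModEquiv 5).symm.tsum_eq]
  have hS' := (Int.divModEquiv 5).symm.summable_iff.2 hS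
  rw [← (Equiv.prodComm _ _).tsum_eq]
  have hS'' := (Equiv.prodComm (Fin 5) ℤ).summable_iff.2 hS'
  simp only [Function.comp_def] at hS''
  rw [Summable.tsum_prod hS'', tsum_fintype]
  refine Finset.sum_congr rfl fun r _ => ?_
  rw [← tsum_mul_left]
  refine tsum_congr fun m => ?_
  simp only [Equiv.prodComm_apply, Prod.swap, Int.divModEquiv_symm_apply]
  rw [mul_zpow]
  simp only [← zpow_natCast, ← zpow_mul]
  push_cast
  rw [show (m * 5 + (r : ℕ) : ℤ) = r + 5 * m by ring,
    show ((r : ℕ) + 5 * m : ℤ) ^ 2 = (r : ℕ) ^ 2 + 10 * (r : ℕ) * m + 25 * m ^ 2 by ring,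
    zpow_add₀ hs0, zpow_add₀ hs0, zpow_add₀ hv]
  ring

/-- The change of variables onto the index-five sublattice. -/
def latEquiv : Fin 5 × (ℤ × ℤ) ≃ ℤ × ℤ where
  toFun p := (2 * p.2.1 + p.2.2 + (p.1 : ℕ), 2 * p.2.2 - p.2.1)
  invFun p := (⟨((p.1 + 2 * p.2) % 5).toNat, by omega⟩,
    (2 * ((p.1 + 2 * p.2) / 5) - p.2, (p.1 + 2 * p.2) / 5))
  left_inv := by
    rintro ⟨⟨r, hr⟩, m, n⟩
    simp only [Prod.mk.injEq, Fin.mk.injEq]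
    refine ⟨?_, ?_, ?_⟩ <;> omega
  right_inv := by
    rintro ⟨a, b⟩
    simp only [Prod.mk.injEq]
    refine ⟨?_, ?_⟩ <;> omega

theorem Th_sq {s v : ℂ} (hs0 : s ≠ 0) (hs : ‖s‖ < 1) (hv : v ≠ 0) :
    Th v s ^ 2 = ∑ r : Fin 5, v ^ (r : ℕ) * s ^ ((r : ℕ) ^ 2) *
      (Th (v * s ^ (4 * (r : ℕ))) (s ^ 5) * Th (v ^ 3 * s ^ (2 * (r : ℕ))) (s ^ 5)) := by
  have hN := theta_summable_norm hs0 hs hv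
  have hS := summable_mul_of_summable_norm hN hN
  have h5 : ‖s ^ 5‖ < 1 := pow_norm_lt hs (by norm_num)
  have h50 : s ^ 5 ≠ 0 := pow_ne_zero _ hs0
  rw [sq]
  conv_lhs => unfold Th
  rw [tsum_mul_tsum_of_summable_norm hN hN, ← latEquiv.tsum_eq]
  have hS' := latEquiv.summable_iff.2 hS
  simp only [Function.comp_def] at hS'
  rw [Summable.tsum_prod hS', tsum_fintype]
  refine Finset.sum_congr rfl fun r _ => ?_
  unfold Th
  rw [tsum_mul_tsum_of_summable_norm
    (theta_summable_norm h50 h5 (mul_ne_zero hv (pow_ne_zero _ hs0)))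
    (theta_summable_norm h50 h5 (mul_ne_zero (pow_ne_zero 3 hv) (pow_ne_zero _ hs0))),
    ← tsum_mul_left]
  refine tsum_congr fun p => ?_
  obtain ⟨m, n⟩ := p
  simp only [latEquiv, Equiv.coe_fn_mk, mul_zpow]
  simp only [← zpow_natCast, ← zpow_mul]
  push_cast
  have e1 : v ^ (2 * m + n + (r : ℕ) : ℤ) * v ^ (2 * n - m) =
      v ^ ((r : ℕ) : ℤ) * v ^ m * v ^ (3 * n) := by
    rw [← zpow_add₀ hv, ← zpow_add₀ hv, ← zpow_add₀ hv]; congr 1; ring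
  have e2 : s ^ ((2 * m + n + (r : ℕ) : ℤ) ^ 2) * s ^ ((2 * n - m) ^ 2) =
      s ^ (((r : ℕ) : ℤ) ^ 2) * s ^ (4 * ((r : ℕ) : ℤ) * m) * s ^ (5 * m ^ 2) *
      s ^ (2 * ((r : ℕ) : ℤ) * n) * s ^ (5 * n ^ 2) := by
    rw [← zpow_add₀ hs0, ← zpow_add₀ hs0, ← zpow_add₀ hs0, ← zpow_add₀ hs0, ← zpow_add₀ hs0]
    congr 1; ring
  linear_combination s ^ ((2 * m + n + (r : ℕ) : ℤ) ^ 2) * s ^ ((2 * n - m) ^ 2) * e1 +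
    v ^ ((r : ℕ) : ℤ) * v ^ m * v ^ (3 * n) * e2

theorem phi_sum {q : ℂ} (hq0 : q ≠ 0) (hq : ‖q‖ < 1) :
    Th (-1) q ^ 2 - Th (-1) (q ^ 5) ^ 2 = -4 * q * (Th (-q ^ 4) (q ^ 5) * Th (-q ^ 2) (q ^ 5)) := by
  have h5 : q ^ 5 ≠ 0 := pow_ne_zero _ hq0
  have hp : ∀ n : ℕ, -q ^ n ≠ 0 := fun n => neg_ne_zero.2 (pow_ne_zero _ hq0)
  rw [Th_sq hq0 hq (neg_ne_zero.2 one_ne_zero)]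
  simp [Fin.sum_univ_succ]
  have a8 : Th (-q ^ 8) (q ^ 5) = _ := Th_reflect (w := -q ^ 2) h5 (hp 2) (by ring)
  have a6 : Th (-q ^ 6) (q ^ 5) = _ := Th_reflect (w := -q ^ 4) h5 (hp 4) (by ring)
  have a12 : Th (-q ^ 12) (q ^ 5) = _ := Th_shift' (w := -q ^ 2) h5 (hp 2) (by ring)
  have a16 : Th (-q ^ 16) (q ^ 5) = _ := Th_shift' (w := -q ^ 6) h5 (hp 6) (by ring)
  norm_num [Odd.neg_pow (show Odd 3 by decide)]
  rw [a16, a12, a8, a6]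
  field_simp
  ring

theorem psi_sum {t : ℂ} (ht0 : t ≠ 0) (ht : ‖t‖ < 1) :
    Th t t ^ 2 - t ^ 2 * Th (t ^ 5) (t ^ 5) ^ 2 = 4 * (Th t (t ^ 5) * Th (t ^ 3) (t ^ 5)) := by
  have h5 : t ^ 5 ≠ 0 := pow_ne_zero _ ht0
  have hp : ∀ n : ℕ, t ^ n ≠ 0 := fun n => pow_ne_zero _ ht0
  rw [Th_sq ht0 ht ht0]
  simp [Fin.sum_univ_succ, ← pow_add, ← pow_succ']
  have a7 : Th (t ^ 7) (t ^ 5) = _ := Th_reflect (w := t ^ 3) h5 (hp 3) (by ring)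
  have a9 : Th (t ^ 9) (t ^ 5) = _ := Th_reflect (w := t) h5 ht0 (by ring)
  have a11 : Th (t ^ 11) (t ^ 5) = _ := Th_shift' (w := t) h5 ht0 (by ring)
  have a13 : Th (t ^ 13) (t ^ 5) = _ := Th_shift' (w := t ^ 3) h5 (hp 3) (by ring)
  have a17 : Th (t ^ 17) (t ^ 5) = _ := Th_shift' (w := t ^ 7) h5 (hp 7) (by ring)
  norm_num
  rw [a17, a13, a11, a9, a7]
  field_simp
  ring

theorem T_sum {t z : ℂ} (ht0 : t ≠ 0) (ht : ‖t‖ < 1) (hz : z ^ 5 = 1) :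
    Th (-z * t) t = (1 - z ^ 4) * Th (-t ^ 5) (t ^ 25) -
      (z - z ^ 3) * t ^ 2 * Th (-t ^ 15) (t ^ 25) := by
  have h5 : t ^ 25 ≠ 0 := pow_ne_zero _ ht0
  have hz0 : z ≠ 0 := by rintro rfl; norm_num at hz
  have hp : ∀ n : ℕ, -t ^ n ≠ 0 := fun n => neg_ne_zero.2 (pow_ne_zero _ ht0)
  have a25 : Th (-t ^ 25) (t ^ 25) = _ := Th_reflect (w := -t ^ 25) h5 (hp 25) (by ring)
  have a25' : Th (-t ^ 25) (t ^ 25) = 0 := by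
    rw [neg_mul, mul_inv_cancel₀ h5] at a25
    linear_combination a25 / 2
  have a35 : Th (-t ^ 35) (t ^ 25) = _ := Th_reflect (w := -t ^ 15) h5 (hp 15) (by ring)
  have a45 : Th (-t ^ 45) (t ^ 25) = _ := Th_reflect (w := -t ^ 5) h5 (hp 5) (by ring)
  rw [Th_dissect ht0 ht (mul_ne_zero (neg_ne_zero.2 hz0) ht0)]
  have e : ∀ k : ℕ, (-z * t) ^ 5 * t ^ (10 * k) = -t ^ (10 * k + 5) := by
    intro k
    rw [pow_add]
    linear_combination (-t ^ 5 * t ^ (10 * k)) * hz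
  simp only [e]
  simp [Fin.sum_univ_succ]
  rw [a45, a35, a25']
  field_simp
  ring

/-! ## Product evaluations and the level 10 relations -/

theorem E_ne {q : ℂ} (hq : ‖q‖ < 1) : qpoch q q ≠ 0 := qp_ne_zero' hq hq

theorem E_odd {q : ℂ} (hq : ‖q‖ < 1) : qpoch q q = qpoch q (q ^ 2) * qpoch (q ^ 2) (q ^ 2) := by
  rw [qp_split q hq two_ne_zero]
  simp [Finset.prod_range_succ, sq]

theorem E_split5 {q : ℂ} (hq : ‖q‖ < 1) : qpoch q q = qpoch q (q ^ 5) * qpoch (q ^ 2) (q ^ 5) *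
    qpoch (q ^ 3) (q ^ 5) * qpoch (q ^ 4) (q ^ 5) * qpoch (q ^ 5) (q ^ 5) := by
  rw [qp_split q hq (show 5 ≠ 0 by norm_num)]
  simp [Finset.prod_range_succ, ← pow_succ']

theorem phi_prod {q : ℂ} (hq0 : q ≠ 0) (hq : ‖q‖ < 1) :
    Th (-1) q * qpoch (q ^ 2) (q ^ 2) = qpoch q q ^ 2 := by
  rw [jtp hq0 hq (by norm_num), E_odd hq]
  norm_num
  ring

theorem phi_prod2 {q : ℂ} (hq0 : q ≠ 0) (hq : ‖q‖ < 1) :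
    Th (-q ^ 4) (q ^ 5) * Th (-q ^ 2) (q ^ 5) * qpoch (q ^ 2) (q ^ 2) * qpoch (q ^ 5) (q ^ 5) =
      qpoch q q * qpoch (q ^ 10) (q ^ 10) ^ 3 := by
  have h5 : q ^ 5 ≠ 0 := pow_ne_zero _ hq0
  have h5' : ‖q ^ 5‖ < 1 := pow_norm_lt hq (by norm_num)
  have h2' : ‖q ^ 2‖ < 1 := pow_norm_lt hq (by norm_num)
  have hp : ∀ n : ℕ, -q ^ n ≠ 0 := fun n => neg_ne_zero.2 (pow_ne_zero _ hq0)
  rw [jtp h5 h5' (hp 4), jtp h5 h5' (hp 2), E_odd h5', E_odd hq, qp_split q h2' (m := 5) (by norm_num)]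
  have e1 : -(-q ^ 4 * q ^ 5) = q ^ 9 := by ring
  have e2 : -((-q ^ 4)⁻¹ * q ^ 5) = q := by rw [inv_neg]; field_simp
  have e3 : -(-q ^ 2 * q ^ 5) = q ^ 7 := by ring
  have e4 : -((-q ^ 2)⁻¹ * q ^ 5) = q ^ 3 := by rw [inv_neg]; field_simp
  rw [e1, e2, e3, e4]
  simp only [Finset.prod_range_succ, Finset.prod_range_zero, one_mul, ← pow_mul, ← pow_succ']
  norm_num
  ring

theorem psi_prod {t : ℂ} (ht0 : t ≠ 0) (ht : ‖t‖ < 1) :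
    Th t t * qpoch (t ^ 2) (t ^ 2) = 2 * qpoch (t ^ 4) (t ^ 4) ^ 2 := by
  have h2' : ‖t ^ 2‖ < 1 := pow_norm_lt ht (by norm_num)
  have h := qp_neg (t ^ 2) h2'
  rw [jtp ht0 ht ht0, inv_mul_cancel₀ ht0, qp_shift (-1) h2', ← sq,
    show t ^ 4 = (t ^ 2) ^ 2 by ring, ← h]
  norm_num
  ring

theorem psi_prod2 {t : ℂ} (ht0 : t ≠ 0) (ht : ‖t‖ < 1) :
    Th t (t ^ 5) * Th (t ^ 3) (t ^ 5) * qpoch (t ^ 20) (t ^ 20) * qpoch (t ^ 2) (t ^ 2) =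
      qpoch (t ^ 10) (t ^ 10) ^ 3 * qpoch (t ^ 4) (t ^ 4) := by
  have h5 : t ^ 5 ≠ 0 := pow_ne_zero _ ht0
  have h5' : ‖t ^ 5‖ < 1 := pow_norm_lt ht (by norm_num)
  have h2' : ‖t ^ 2‖ < 1 := pow_norm_lt ht (by norm_num)
  have h10' : ‖t ^ 10‖ < 1 := pow_norm_lt ht (by norm_num)
  have h := qp_neg (t ^ 2) h2'
  have h' := qp_neg (t ^ 10) h10'
  have e1 : t⁻¹ * t ^ 5 = t ^ 4 := by field_simp
  have e2 : (t ^ 3)⁻¹ * t ^ 5 = t ^ 2 := by field_simp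
  rw [jtp h5 h5' ht0, jtp h5 h5' (pow_ne_zero 3 ht0), e1, e2,
    show t ^ 4 = (t ^ 2) ^ 2 by ring, show t ^ 20 = (t ^ 10) ^ 2 by ring, ← h, ← h',
    qp_split (-t ^ 2) h2' (m := 5) (by norm_num)]
  simp only [Finset.prod_range_succ, Finset.prod_range_zero, one_mul, ← pow_mul, ← pow_succ',
    ← pow_add, neg_mul]
  norm_num
  ring

theorem J_prod {s : ℂ} (hs0 : s ≠ 0) (hs : ‖s‖ < 1) :
    Th (-s) (s ^ 5) * Th (-s ^ 3) (s ^ 5) = qpoch (s ^ 10) (s ^ 10) * qpoch (s ^ 2) (s ^ 2) := by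
  have h5 : s ^ 5 ≠ 0 := pow_ne_zero _ hs0
  have h5' : ‖s ^ 5‖ < 1 := pow_norm_lt hs (by norm_num)
  have h2' : ‖s ^ 2‖ < 1 := pow_norm_lt hs (by norm_num)
  rw [jtp h5 h5' (neg_ne_zero.2 hs0), jtp h5 h5' (neg_ne_zero.2 (pow_ne_zero 3 hs0)), E_split5 h2']
  have e1 : -(-s * s ^ 5) = s ^ 6 := by ring
  have e2 : -((-s)⁻¹ * s ^ 5) = s ^ 4 := by rw [inv_neg]; field_simp
  have e3 : -(-s ^ 3 * s ^ 5) = s ^ 8 := by ring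
  have e4 : -((-s ^ 3)⁻¹ * s ^ 5) = s ^ 2 := by rw [inv_neg]; field_simp
  rw [e1, e2, e3, e4]
  simp only [← pow_mul]
  norm_num
  ring

/-- `φ(-q)² - φ(-q⁵)² = -4 q E₁ E₁₀³ / (E₂ E₅)`. -/
theorem phi_rel {q : ℂ} (hq0 : q ≠ 0) (hq : ‖q‖ < 1) :
    (qpoch q q ^ 2 / qpoch (q ^ 2) (q ^ 2)) ^ 2 -
      (qpoch (q ^ 5) (q ^ 5) ^ 2 / qpoch (q ^ 10) (q ^ 10)) ^ 2 =
    -4 * q * (qpoch q q * qpoch (q ^ 10) (q ^ 10) ^ 3 /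
      (qpoch (q ^ 2) (q ^ 2) * qpoch (q ^ 5) (q ^ 5))) := by
  have h5 : q ^ 5 ≠ 0 := pow_ne_zero _ hq0
  have h5' : ‖q ^ 5‖ < 1 := pow_norm_lt hq (by norm_num)
  have n2 := E_ne (pow_norm_lt hq (show 2 ≠ 0 by norm_num))
  have n5 := E_ne (pow_norm_lt hq (show 5 ≠ 0 by norm_num))
  have n10 := E_ne (pow_norm_lt hq (show 10 ≠ 0 by norm_num))
  have a := phi_prod hq0 hq
  have b := phi_prod h5 h5'
  rw [← pow_mul] at b
  norm_num at b
  rw [← a, ← b, ← phi_prod2 hq0 hq]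
  have := phi_sum hq0 hq
  field_simp
  linear_combination this

/-- `ψ(q)² - q ψ(q⁵)² = E₂ E₅³ / (E₁ E₁₀)`. -/
theorem psi_rel {q : ℂ} (hq0 : q ≠ 0) (hq : ‖q‖ < 1) :
    (qpoch (q ^ 2) (q ^ 2) ^ 2 / qpoch q q) ^ 2 -
      q * (qpoch (q ^ 10) (q ^ 10) ^ 2 / qpoch (q ^ 5) (q ^ 5)) ^ 2 =
    qpoch (q ^ 5) (q ^ 5) ^ 3 * qpoch (q ^ 2) (q ^ 2) /
      (qpoch (q ^ 10) (q ^ 10) * qpoch q q) := by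
  obtain ⟨t, rfl⟩ := IsAlgClosed.exists_pow_nat_eq q (n := 2) two_pos
  have ht0 : t ≠ 0 := by rintro rfl; simp at hq0
  have ht : ‖t‖ < 1 := by
    rw [norm_pow] at hq
    exact (pow_lt_one_iff_of_nonneg (norm_nonneg _) two_ne_zero).1 hq
  simp only [← pow_mul]
  norm_num
  have n1 := E_ne (pow_norm_lt ht (show 2 ≠ 0 by norm_num))
  have n2 := E_ne (pow_norm_lt ht (show 4 ≠ 0 by norm_num))
  have n5 := E_ne (pow_norm_lt ht (show 10 ≠ 0 by norm_num))
  have n10 := E_ne (pow_norm_lt ht (show 20 ≠ 0 by norm_num))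
  have h5 : t ^ 5 ≠ 0 := pow_ne_zero _ ht0
  have h5' : ‖t ^ 5‖ < 1 := pow_norm_lt ht (by norm_num)
  have a := psi_prod ht0 ht
  have b := psi_prod h5 h5'
  simp only [← pow_mul] at b
  norm_num at b
  have a' : qpoch (t ^ 4) (t ^ 4) ^ 2 = Th t t * qpoch (t ^ 2) (t ^ 2) / 2 := by rw [a]; ring
  have b' : qpoch (t ^ 20) (t ^ 20) ^ 2 = Th (t ^ 5) (t ^ 5) * qpoch (t ^ 10) (t ^ 10) / 2 := by
    rw [b]; ring
  rw [a', b', ← psi_prod2 ht0 ht]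
  have := psi_sum ht0 ht
  field_simp
  linear_combination this

/-- The 5-dissection of `E`. -/
theorem T_rel {t z : ℂ} (ht0 : t ≠ 0) (ht : ‖t‖ < 1) (hz : z ^ 4 + z ^ 3 + z ^ 2 + z + 1 = 0) :
    qpoch (t ^ 2) (t ^ 2) * qpoch (t ^ 10) (t ^ 10) =
      Th (-t ^ 5) (t ^ 25) ^ 2 - t ^ 2 * (Th (-t ^ 5) (t ^ 25) * Th (-t ^ 15) (t ^ 25)) -
      t ^ 4 * Th (-t ^ 15) (t ^ 25) ^ 2 := by
  have h2' : ‖t ^ 2‖ < 1 := pow_norm_lt ht (by norm_num)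
  have h5 : z ^ 5 = 1 := by linear_combination (z - 1) * hz
  have hz0 : z ≠ 0 := by rintro rfl; norm_num at hz
  have h10 : (z ^ 2) ^ 5 = 1 := by linear_combination (z ^ 5 + 1) * h5
  have n1 := E_ne h2'
  have a := T_sum ht0 ht h5
  have b := T_sum ht0 ht h10
  rw [jtp ht0 ht (mul_ne_zero (neg_ne_zero.2 hz0) ht0)] at a
  rw [jtp ht0 ht (mul_ne_zero (neg_ne_zero.2 (pow_ne_zero 2 hz0)) ht0)] at b
  have i1 : -((-z * t)⁻¹ * t) = z ^ 4 := by
    field_simp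
    linear_combination -h5
  have i2 : -((-z ^ 2 * t)⁻¹ * t) = z ^ 3 := by
    field_simp
    linear_combination -h5
  have i3 : -(-z * t * t) = z * t ^ 2 := by ring
  have i4 : -(-z ^ 2 * t * t) = z ^ 2 * t ^ 2 := by ring
  rw [i1, i3, qp_shift (z ^ 4) h2'] at a
  rw [i2, i4, qp_shift (z ^ 3) h2'] at b
  have c := qp_five (t ^ 2) z hz h2'
  rw [← pow_mul] at c
  norm_num at c
  have w1 : 1 - z ^ 4 ≠ 0 := by
    intro h
    have e1 : z = 1 := by linear_combination h5 + z * h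
    rw [e1] at hz
    norm_num at hz
  have w2 : 1 - z ^ 3 ≠ 0 := by
    intro h
    have e1 : z = 1 := by linear_combination -z * h5 - (1 + z ^ 3) * h
    rw [e1] at hz
    norm_num at hz
  set J0 := Th (-t ^ 5) (t ^ 25)
  set J1 := Th (-t ^ 15) (t ^ 25)
  have a2 : qpoch (t ^ 2) (t ^ 2) * qpoch (z * t ^ 2) (t ^ 2) * qpoch (z ^ 4 * t ^ 2) (t ^ 2) =
      J0 + (z ^ 2 + z ^ 3) * t ^ 2 * J1 := by
    apply mul_left_cancel₀ w1
    linear_combination a + t ^ 2 * J1 * (z + z ^ 2) * h5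
  have b2 : qpoch (t ^ 2) (t ^ 2) * qpoch (z ^ 2 * t ^ 2) (t ^ 2) * qpoch (z ^ 3 * t ^ 2) (t ^ 2) =
      J0 + (z ^ 4 + z) * t ^ 2 * J1 := by
    apply mul_left_cancel₀ w2
    linear_combination b + (- J0 * z ^ 3) * h5 + t ^ 2 * J1 * (z + z ^ 2) * h5
  rw [← c]
  have e : qpoch (t ^ 2) (t ^ 2) * (qpoch (t ^ 2) (t ^ 2) * qpoch (z * t ^ 2) (t ^ 2) *
      qpoch (z ^ 2 * t ^ 2) (t ^ 2) * qpoch (z ^ 3 * t ^ 2) (t ^ 2) * qpoch (z ^ 4 * t ^ 2) (t ^ 2))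
      = (J0 + (z ^ 2 + z ^ 3) * t ^ 2 * J1) * (J0 + (z ^ 4 + z) * t ^ 2 * J1) := by
    rw [← a2, ← b2]; ring
  rw [e]
  linear_combination (t ^ 2 * J0 * J1) * hz + t ^ 4 * J1 ^ 2 * (hz + (z + z ^ 2) * h5)

/-! ## The 5-dissection argument -/

theorem z_pow_mod {z : ℂ} (h5 : z ^ 5 = 1) (n : ℕ) : z ^ n = z ^ (n % 5) := by
  conv_lhs => rw [← Nat.div_add_mod n 5, pow_add, pow_mul, h5, one_pow, one_mul]

theorem prod_E {q z : ℂ} (hq : ‖q‖ < 1) (hz : z ^ 4 + z ^ 3 + z ^ 2 + z + 1 = 0) :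
    qpoch q q * qpoch (z * q) (z * q) * qpoch (z ^ 2 * q) (z ^ 2 * q) *
      qpoch (z ^ 3 * q) (z ^ 3 * q) * qpoch (z ^ 4 * q) (z ^ 4 * q) * qpoch (q ^ 25) (q ^ 25) =
    qpoch (q ^ 5) (q ^ 5) ^ 6 := by
  have h5 : z ^ 5 = 1 := by linear_combination (z - 1) * hz
  have hzn : ‖z‖ = 1 := Complex.norm_eq_one_of_pow_eq_one h5 (by norm_num)
  have hn : ∀ k : ℕ, ‖z ^ k * q‖ < 1 := by
    intro k; rw [norm_mul, norm_pow, hzn, one_pow, one_mul]; exact hq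
  have hq5 : ‖q ^ 5‖ < 1 := pow_norm_lt hq (by norm_num)
  have hs : ∀ k : ℕ, qpoch (z ^ k * q) (z ^ k * q) = qpoch (z ^ k * q) (q ^ 5) *
      qpoch (z ^ ((2 * k) % 5) * q ^ 2) (q ^ 5) * qpoch (z ^ ((3 * k) % 5) * q ^ 3) (q ^ 5) *
      qpoch (z ^ ((4 * k) % 5) * q ^ 4) (q ^ 5) * qpoch (q ^ 5) (q ^ 5) := by
    intro k
    have e5 : (z ^ k * q) ^ 5 = q ^ 5 := by
      rw [mul_pow, ← pow_mul, mul_comm k 5, pow_mul, h5, one_pow, one_mul]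
    rw [E_split5 (hn k), e5, ← z_pow_mod h5, ← z_pow_mod h5, ← z_pow_mod h5]
    simp only [mul_pow, ← pow_mul, mul_comm k]
  have s0 := hs 0
  have s1 := hs 1
  have s2 := hs 2
  have s3 := hs 3
  have s4 := hs 4
  norm_num at s0 s1 s2 s3 s4
  have f1 := qp_five q z hz hq5
  have f2 := qp_five (q ^ 2) z hz hq5
  have f3 := qp_five (q ^ 3) z hz hq5
  have f4 := qp_five (q ^ 4) z hz hq5
  have s := E_split5 hq5
  simp only [← pow_mul] at f1 f2 f3 f4 s
  norm_num at f1 f2 f3 f4 s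
  rw [s0, s1, s2, s3, s4]
  have e6 : qpoch (q ^ 5) (q ^ 5) ^ 6 = qpoch (q ^ 5) (q ^ 5) ^ 5 * qpoch (q ^ 5) (q ^ 5) := by ring
  rw [e6]
  nth_rewrite 7 [s]
  rw [← f1, ← f2, ← f3, ← f4]
  ring

theorem norm_poly {z : ℂ} (hz : z ^ 4 + z ^ 3 + z ^ 2 + z + 1 = 0) (α β u : ℂ) :
    (α ^ 2 - z * u * (α * β) - z ^ 2 * u ^ 2 * β ^ 2) *
    (α ^ 2 - z ^ 4 * u * (α * β) - z ^ 3 * u ^ 2 * β ^ 2) *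
    ((α ^ 2 - z ^ 2 * u * (α * β) - z ^ 4 * u ^ 2 * β ^ 2) *
    (α ^ 2 - z ^ 3 * u * (α * β) - z * u ^ 2 * β ^ 2)) =
    α ^ 8 + u * α ^ 7 * β + 2 * u ^ 2 * α ^ 6 * β ^ 2 + 3 * u ^ 3 * α ^ 5 * β ^ 3 +
      5 * u ^ 4 * α ^ 4 * β ^ 4 - 3 * u ^ 5 * α ^ 3 * β ^ 5 + 2 * u ^ 6 * α ^ 2 * β ^ 6 -
      u ^ 7 * α * β ^ 7 + u ^ 8 * β ^ 8 := by
  have h5 : z ^ 5 = 1 := by linear_combination (z - 1) * hz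
  obtain ⟨c, hc⟩ : ∃ c, c = z + z ^ 4 := ⟨_, rfl⟩
  have hd : z ^ 2 + z ^ 3 = -1 - c := by rw [hc]; linear_combination hz
  have hcc : c ^ 2 + c - 1 = 0 := by
    rw [hc]; linear_combination hz + (2 + z ^ 3) * h5
  have q1 : (α ^ 2 - z * u * (α * β) - z ^ 2 * u ^ 2 * β ^ 2) *
      (α ^ 2 - z ^ 4 * u * (α * β) - z ^ 3 * u ^ 2 * β ^ 2) =
      α ^ 4 + u ^ 2 * α ^ 2 * β ^ 2 + u ^ 4 * β ^ 4 - c * u * α ^ 3 * β +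
        (1 + c) * u ^ 2 * α ^ 2 * β ^ 2 + c * u ^ 3 * α * β ^ 3 := by
    rw [hc]
    linear_combination (-u ^ 2 * α ^ 2 * β ^ 2) * (hd - hc) +
      (u ^ 2 * α ^ 2 * β ^ 2 + u ^ 4 * β ^ 4 + z * u ^ 3 * α * β ^ 3) * h5
  have q2 : (α ^ 2 - z ^ 2 * u * (α * β) - z ^ 4 * u ^ 2 * β ^ 2) *
      (α ^ 2 - z ^ 3 * u * (α * β) - z * u ^ 2 * β ^ 2) =
      α ^ 4 + u ^ 2 * α ^ 2 * β ^ 2 + u ^ 4 * β ^ 4 + (1 + c) * u * α ^ 3 * β -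
        c * u ^ 2 * α ^ 2 * β ^ 2 - (1 + c) * u ^ 3 * α * β ^ 3 := by
    rw [hc]
    linear_combination (-u * α ^ 3 * β + u ^ 3 * α * β ^ 3) * (hd - hc) +
      (u ^ 2 * α ^ 2 * β ^ 2 + u ^ 4 * β ^ 4 + z ^ 2 * u ^ 3 * α * β ^ 3) * h5
  rw [q1, q2]
  linear_combination (-(u ^ 2 * α ^ 2 * β ^ 2 - u * α ^ 3 * β + u ^ 3 * α * β ^ 3) ^ 2) * hcc

/-- The combination of the two eta quotients which is dissected below. -/
noncomputable def GG (q : ℂ) : ℂ :=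
  qpoch q q ^ 5 / qpoch (q ^ 5) (q ^ 5) + 5 * (q * (qpoch (q ^ 5) (q ^ 5) ^ 5 / qpoch q q))

theorem GG_eval {t z : ℂ} (ht0 : t ≠ 0) (ht : ‖t‖ < 1) (hz : z ^ 4 + z ^ 3 + z ^ 2 + z + 1 = 0)
    (α β u : ℂ) (hα : α = Th (-t ^ 5) (t ^ 25)) (hβ : β = Th (-t ^ 15) (t ^ 25)) (hu : u = t ^ 2) :
    GG u * qpoch (u ^ 5) (u ^ 5) ^ 6 = α ^ 10 + 10 * α ^ 8 * β ^ 2 * u ^ 2 +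
      20 * α ^ 7 * β ^ 3 * u ^ 3 + 14 * α ^ 5 * β ^ 5 * u ^ 5 + 20 * α ^ 3 * β ^ 7 * u ^ 7 -
      10 * α ^ 2 * β ^ 8 * u ^ 8 - β ^ 10 * u ^ 10 := by
  have h5 : z ^ 5 = 1 := by linear_combination (z - 1) * hz
  have hz0 : z ≠ 0 := by rintro rfl; norm_num at hz
  have hzn : ‖z‖ = 1 := Complex.norm_eq_one_of_pow_eq_one h5 (by norm_num)
  have huq : ‖u‖ < 1 := by rw [hu]; exact pow_norm_lt ht (by norm_num)
  have key : ∀ k : ℕ, qpoch (z ^ k * u) (z ^ k * u) * qpoch (u ^ 5) (u ^ 5) =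
      α ^ 2 - z ^ k * u * (α * β) - z ^ (2 * k) * u ^ 2 * β ^ 2 := by
    intro k
    have h3 : (z ^ (3 * k)) ^ 5 = 1 := by rw [← pow_mul, mul_comm, pow_mul, h5, one_pow]
    have hb0 : z ^ (3 * k) * t ≠ 0 := mul_ne_zero (pow_ne_zero _ hz0) ht0
    have hb : ‖z ^ (3 * k) * t‖ < 1 := by
      rw [norm_mul, norm_pow, hzn, one_pow, one_mul]; exact ht
    have h := T_rel hb0 hb hz
    have e5 : (z ^ (3 * k) * t) ^ 5 = t ^ 5 := by rw [mul_pow, h3, one_mul]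
    have e10 : (z ^ (3 * k) * t) ^ 10 = u ^ 5 := by
      rw [show 10 = 5 * 2 by norm_num, pow_mul, e5, hu]; ring
    have e15 : (z ^ (3 * k) * t) ^ 15 = t ^ 15 := by
      rw [show 15 = 5 * 3 by norm_num, pow_mul, e5]; ring
    have e25 : (z ^ (3 * k) * t) ^ 25 = t ^ 25 := by
      rw [show 25 = 5 * 5 by norm_num, pow_mul, e5]; ring
    have e2 : (z ^ (3 * k) * t) ^ 2 = z ^ k * u := by
      have : z ^ (5 * k) = 1 := by rw [pow_mul, h5, one_pow]
      rw [hu]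
      linear_combination z ^ k * t ^ 2 * this
    have e4 : (z ^ (3 * k) * t) ^ 4 = z ^ (2 * k) * u ^ 2 := by
      rw [show 4 = 2 * 2 by norm_num, pow_mul, e2]; ring
    rw [e2, e4, e5, e10, e15, e25, ← hα, ← hβ] at h
    exact h
  have k0 := key 0
  have k1 := key 1
  have k2 := key 2
  have k3 := key 3
  have k4 := key 4
  have z6 : z ^ 6 = z := by linear_combination z * h5
  have z8 : z ^ 8 = z ^ 3 := by linear_combination z ^ 3 * h5
  norm_num [z6, z8] at k0 k1 k2 k3 k4
  have hJ : α * β = qpoch (u ^ 25) (u ^ 25) * qpoch (u ^ 5) (u ^ 5) := by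
    have := J_prod (pow_ne_zero 5 ht0) (pow_norm_lt ht (show 5 ≠ 0 by norm_num))
    simp only [← pow_mul] at this
    norm_num at this
    rw [hα, hβ, hu, ← pow_mul, ← pow_mul]
    exact this
  have hP := prod_E huq hz
  have hN := norm_poly hz α β u
  rw [← k1, ← k2, ← k3, ← k4] at hN
  have n1 := E_ne huq
  have n5 := E_ne (pow_norm_lt huq (show 5 ≠ 0 by norm_num))
  unfold GG
  set e0 := qpoch u u
  set e1 := qpoch (z * u) (z * u)
  set e2 := qpoch (z ^ 2 * u) (z ^ 2 * u)
  set e3 := qpoch (z ^ 3 * u) (z ^ 3 * u)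
  set e4 := qpoch (z ^ 4 * u) (z ^ 4 * u)
  set E5 := qpoch (u ^ 5) (u ^ 5)
  set E25 := qpoch (u ^ 25) (u ^ 25)
  have g1 : (e0 ^ 5 / E5) * E5 ^ 6 = (e0 * E5) ^ 5 := by field_simp
  have g2 : (E5 ^ 5 / e0) * E5 ^ 6 = (α * β) * (e1 * E5 * (e4 * E5) * (e2 * E5 * (e3 * E5))) := by
    rw [hJ, ← hP]
    field_simp
  rw [add_mul, g1, k0, show 5 * (u * (E5 ^ 5 / e0)) * E5 ^ 6 = 5 * u * ((E5 ^ 5 / e0) * E5 ^ 6) by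
    ring, g2, hN]
  ring

theorem GG_sum {q z : ℂ} (hq0 : q ≠ 0) (hq : ‖q‖ < 1) (hz : z ^ 4 + z ^ 3 + z ^ 2 + z + 1 = 0) :
    ∑ k ∈ Finset.range 5, z ^ k * GG (z ^ k * q) = 0 := by
  have h5 : z ^ 5 = 1 := by linear_combination (z - 1) * hz
  have hz0 : z ≠ 0 := by rintro rfl; norm_num at hz
  have hzn : ‖z‖ = 1 := Complex.norm_eq_one_of_pow_eq_one h5 (by norm_num)
  obtain ⟨t, rfl⟩ := IsAlgClosed.exists_pow_nat_eq q (n := 2) two_pos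
  have ht0 : t ≠ 0 := by rintro rfl; simp at hq0
  have ht : ‖t‖ < 1 := by
    rw [norm_pow] at hq
    exact (pow_lt_one_iff_of_nonneg (norm_nonneg _) two_ne_zero).1 hq
  have n5 := E_ne (pow_norm_lt hq (show 5 ≠ 0 by norm_num))
  obtain ⟨α, hα⟩ : ∃ α, α = Th (-t ^ 5) (t ^ 25) := ⟨_, rfl⟩
  obtain ⟨β, hβ⟩ : ∃ β, β = Th (-t ^ 15) (t ^ 25) := ⟨_, rfl⟩
  have key : ∀ k : ℕ, GG (z ^ k * t ^ 2) * qpoch ((t ^ 2) ^ 5) ((t ^ 2) ^ 5) ^ 6 =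
      α ^ 10 + 10 * α ^ 8 * β ^ 2 * (z ^ k * t ^ 2) ^ 2 +
      20 * α ^ 7 * β ^ 3 * (z ^ k * t ^ 2) ^ 3 + 14 * α ^ 5 * β ^ 5 * (z ^ k * t ^ 2) ^ 5 +
      20 * α ^ 3 * β ^ 7 * (z ^ k * t ^ 2) ^ 7 -
      10 * α ^ 2 * β ^ 8 * (z ^ k * t ^ 2) ^ 8 - β ^ 10 * (z ^ k * t ^ 2) ^ 10 := by
    intro k
    have h3 : (z ^ (3 * k)) ^ 5 = 1 := by rw [← pow_mul, mul_comm, pow_mul, h5, one_pow]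
    have hb0 : z ^ (3 * k) * t ≠ 0 := mul_ne_zero (pow_ne_zero _ hz0) ht0
    have hb : ‖z ^ (3 * k) * t‖ < 1 := by
      rw [norm_mul, norm_pow, hzn, one_pow, one_mul]; exact ht
    have e5 : (z ^ (3 * k) * t) ^ 5 = t ^ 5 := by rw [mul_pow, h3, one_mul]
    have e15 : (z ^ (3 * k) * t) ^ 15 = t ^ 15 := by
      rw [show 15 = 5 * 3 by norm_num, pow_mul, e5]; ring
    have e25 : (z ^ (3 * k) * t) ^ 25 = t ^ 25 := by
      rw [show 25 = 5 * 5 by norm_num, pow_mul, e5]; ring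
    have hk : z ^ (5 * k) = 1 := by rw [pow_mul, h5, one_pow]
    have e2 : z ^ k * t ^ 2 = (z ^ (3 * k) * t) ^ 2 := by
      linear_combination -z ^ k * t ^ 2 * hk
    have eu : (z ^ k * t ^ 2) ^ 5 = (t ^ 2) ^ 5 := by
      linear_combination t ^ 10 * hk
    have := GG_eval hb0 hb hz α β (z ^ k * t ^ 2) (by rw [e5, e25, hα]) (by rw [e15, e25, hβ]) e2
    rw [eu] at this
    rw [this, eu]
  have S : ∀ i : ℕ, (i + 1) % 5 ≠ 0 →
      ∑ k ∈ Finset.range 5, z ^ k * (z ^ k * t ^ 2) ^ i = 0 := by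
    intro i hi
    have e : ∑ k ∈ Finset.range 5, z ^ k * (z ^ k * t ^ 2) ^ i =
        (t ^ 2) ^ i * ∑ k ∈ Finset.range 5, (z ^ ((i + 1) % 5)) ^ k := by
      rw [Finset.mul_sum]
      refine Finset.sum_congr rfl fun k _ => ?_
      rw [← z_pow_mod h5]
      ring
    rw [e]
    have hlt : (i + 1) % 5 < 5 := Nat.mod_lt _ (by norm_num)
    generalize (i + 1) % 5 = r at *
    have : ∑ k ∈ Finset.range 5, (z ^ r) ^ k = 0 := by
      interval_cases r
      · exact absurd rfl hi
      · simp [Finset.sum_range_succ]; linear_combination hz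
      · simp [Finset.sum_range_succ]; linear_combination hz + (z + z ^ 3) * h5
      · simp [Finset.sum_range_succ]; linear_combination hz + (z + z ^ 4 + z ^ 7 + z ^ 2) * h5
      · simp [Finset.sum_range_succ]
        linear_combination hz + (z ^ 3 + z ^ 7 + z ^ 2 + z ^ 11 + z ^ 6 + z) * h5
    rw [this, mul_zero]
  have n6 := pow_ne_zero 6 n5
  apply mul_right_cancel₀ n6
  rw [zero_mul, Finset.sum_mul]
  have e : ∀ k ∈ Finset.range 5, z ^ k * GG (z ^ k * t ^ 2) *
      qpoch ((t ^ 2) ^ 5) ((t ^ 2) ^ 5) ^ 6 =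
      α ^ 10 * (z ^ k * (z ^ k * t ^ 2) ^ 0) +
      10 * α ^ 8 * β ^ 2 * (z ^ k * (z ^ k * t ^ 2) ^ 2) +
      20 * α ^ 7 * β ^ 3 * (z ^ k * (z ^ k * t ^ 2) ^ 3) +
      14 * α ^ 5 * β ^ 5 * (z ^ k * (z ^ k * t ^ 2) ^ 5) +
      20 * α ^ 3 * β ^ 7 * (z ^ k * (z ^ k * t ^ 2) ^ 7) +
      (-10) * α ^ 2 * β ^ 8 * (z ^ k * (z ^ k * t ^ 2) ^ 8) +
      (-β ^ 10) * (z ^ k * (z ^ k * t ^ 2) ^ 10) := by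
    intro k _
    rw [mul_assoc, key k]
    ring
  rw [Finset.sum_congr rfl e]
  simp only [Finset.sum_add_distrib, ← Finset.mul_sum]
  rw [S 0 (by norm_num), S 2 (by norm_num), S 3 (by norm_num), S 5 (by norm_num),
    S 7 (by norm_num), S 8 (by norm_num), S 10 (by norm_num)]
  ring

/-! ## The level 10 identity -/

theorem F_rel {q : ℂ} (hq0 : q ≠ 0) (hq : ‖q‖ < 1) :
    5 * (phiNeg (q ^ 5) ^ 5 / phiNeg q - 2 * (q * (qpoch (q ^ 5) (q ^ 5) ^ 5 / qpoch q q))) =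
      GG q + 4 * GG (q ^ 2) := by
  have n1 := E_ne hq
  have n2 := E_ne (pow_norm_lt hq (show 2 ≠ 0 by norm_num))
  have n5 := E_ne (pow_norm_lt hq (show 5 ≠ 0 by norm_num))
  have n10 := E_ne (pow_norm_lt hq (show 10 ≠ 0 by norm_num))
  have h1 := phi_rel hq0 hq
  have h2 := psi_rel hq0 hq
  unfold phiNeg GG
  simp only [← pow_mul]
  norm_num
  set e1 := qpoch q q
  set e2 := qpoch (q ^ 2) (q ^ 2)
  set e5 := qpoch (q ^ 5) (q ^ 5)
  set e10 := qpoch (q ^ 10) (q ^ 10)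
  obtain ⟨v, hv⟩ : ∃ v, v = q * e1 * e10 ^ 5 / (e2 * e5 ^ 5) := ⟨_, rfl⟩
  have hu : e2 ^ 3 * e10 / (e1 * e5 ^ 3) = 1 + v := by
    rw [hv]
    field_simp at h2 ⊢
    linear_combination h2
  have hw : e1 ^ 4 * e10 ^ 2 / (e2 ^ 2 * e5 ^ 4) = 1 - 4 * v := by
    rw [hv]
    field_simp at h1 ⊢
    linear_combination h1
  obtain ⟨F, hF⟩ : ∃ F, F = (e5 ^ 2 / e10) ^ 5 / (e1 ^ 2 / e2) := ⟨_, rfl⟩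
  have b1 : e1 ^ 5 / e5 = F * ((1 + v) * (1 - 4 * v) ^ 2) := by
    rw [hF, ← hu, ← hw]; field_simp
  have b2 : e2 ^ 5 / e10 = F * ((1 + v) ^ 2 * (1 - 4 * v)) := by
    rw [hF, ← hu, ← hw]; field_simp
  have a1 : q * (e5 ^ 5 / e1) = F * v := by
    rw [hF, hv]; field_simp
  have a2 : q ^ 2 * (e10 ^ 5 / e2) = F * v ^ 2 := by
    rw [hF, hv]; field_simp
  rw [← hF, b1, b2, a1, a2]
  ring

/-! ## Extraction of coefficients -/

theorem coeff_zero_of_hasSum (h : ℕ → ℂ) (H : ∀ q : ℂ, ‖q‖ < 1 → HasSum (fun n => h n * q ^ n) 0) :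
    ∀ n, h n = 0 := by
  have hp : HasFPowerSeriesAt (0 : ℂ → ℂ) (FormalMultilinearSeries.ofScalars ℂ h) 0 := by
    rw [hasFPowerSeriesAt_iff]
    filter_upwards [Metric.ball_mem_nhds (0 : ℂ) one_pos] with q hq
    have := H q (by simpa using hq)
    simpa [FormalMultilinearSeries.coeff_ofScalars, mul_comm] using this
  have h0 := hp.eq_zero
  intro n
  have : (FormalMultilinearSeries.ofScalars ℂ h).coeff n = 0 := by rw [h0]; rfl
  simpa [FormalMultilinearSeries.coeff_ofScalars] using this

theorem stmt_3 (c a : ℕ → ℤ)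
    (hc : ∀ q : ℂ, ‖q‖ < 1 →
      ∑' n : ℕ, (c n : ℂ) * q ^ n = qpoch (q ^ 5) (q ^ 5) ^ 5 / qpoch q q)
    (ha : ∀ q : ℂ, ‖q‖ < 1 →
      ∑' n : ℕ, (a n : ℂ) * q ^ n = phiNeg (q ^ 5) ^ 5 / phiNeg q) :
    ∀ n : ℕ, a (10 * n + 9) = 2 * c (10 * n + 8) := by
  obtain ⟨z, hprim⟩ : ∃ z : ℂ, IsPrimitiveRoot z 5 := ⟨_, Complex.isPrimitiveRoot_exp 5 (by norm_num)⟩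
  have hz : z ^ 4 + z ^ 3 + z ^ 2 + z + 1 = 0 := by
    have := hprim.geom_sum_eq_zero (by norm_num)
    simp [Finset.sum_range_succ] at this
    linear_combination this
  have h5 : z ^ 5 = 1 := by linear_combination (z - 1) * hz
  have hzn : ‖z‖ = 1 := Complex.norm_eq_one_of_pow_eq_one h5 (by norm_num)
  have hz0 : z ≠ 0 := by rintro rfl; norm_num at hz
  have ne : ∀ q : ℂ, ‖q‖ < 1 → ∀ m : ℕ, m ≠ 0 → qpoch (q ^ m) (q ^ m) ≠ 0 :=
    fun q hq m hm => E_ne (pow_norm_lt hq hm)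
  have hsum : ∀ f : ℕ → ℂ, ∀ s : ℂ, s ≠ 0 → ∑' n, f n = s → HasSum f s := by
    intro f s hs h
    have : Summable f := by
      by_contra hn
      exact hs (h ▸ tsum_eq_zero_of_not_summable hn)
    exact h ▸ this.hasSum
  have hC : ∀ q : ℂ, ‖q‖ < 1 → HasSum (fun n : ℕ => (c n : ℂ) * q ^ n)
      (qpoch (q ^ 5) (q ^ 5) ^ 5 / qpoch q q) := fun q hq =>
    hsum _ _ (div_ne_zero (pow_ne_zero _ (ne q hq 5 (by norm_num))) (E_ne hq)) (hc q hq)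
  have phine : ∀ q : ℂ, ‖q‖ < 1 → phiNeg q ≠ 0 := fun q hq =>
    div_ne_zero (pow_ne_zero _ (E_ne hq)) (ne q hq 2 (by norm_num))
  have hA : ∀ q : ℂ, ‖q‖ < 1 → HasSum (fun n : ℕ => (a n : ℂ) * q ^ n)
      (phiNeg (q ^ 5) ^ 5 / phiNeg q) := fun q hq =>
    hsum _ _ (div_ne_zero (pow_ne_zero _ (phine _ (pow_norm_lt hq (by norm_num)))) (phine q hq))
      (ha q hq)
  let c' : ℕ → ℂ := fun n => if n = 0 then 0 else (c (n - 1) : ℂ)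
  have hC' : ∀ q : ℂ, ‖q‖ < 1 → HasSum (fun n : ℕ => c' n * q ^ n)
      (q * (qpoch (q ^ 5) (q ^ 5) ^ 5 / qpoch q q)) := by
    intro q hq
    have h := (hC q hq).mul_left q
    have h' : HasSum (fun n : ℕ => c' (n + 1) * q ^ (n + 1))
        (q * (qpoch (q ^ 5) (q ^ 5) ^ 5 / qpoch q q)) := by
      have e : (fun n : ℕ => c' (n + 1) * q ^ (n + 1)) =
          fun n : ℕ => q * ((c n : ℂ) * q ^ n) := by
        funext n
        simp only [c', Nat.add_sub_cancel, Nat.succ_ne_zero, if_false]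
        ring
      rw [e]
      exact h
    have := (hasSum_nat_add_iff (f := fun n : ℕ => c' n * q ^ n) 1).1 h'
    simpa [c'] using this
  let d : ℕ → ℂ := fun n => (a n : ℂ) - 2 * c' n
  let D : ℂ → ℂ := fun q =>
    phiNeg (q ^ 5) ^ 5 / phiNeg q - 2 * (q * (qpoch (q ^ 5) (q ^ 5) ^ 5 / qpoch q q))
  have hD : ∀ q : ℂ, ‖q‖ < 1 → HasSum (fun n : ℕ => d n * q ^ n) (D q) := by
    intro q hq
    have e : (fun n : ℕ => d n * q ^ n) =
        fun n : ℕ => (a n : ℂ) * q ^ n - 2 * (c' n * q ^ n) := by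
      funext n; simp only [d]; ring
    rw [e]
    exact (hA q hq).sub ((hC' q hq).mul_left 2)
  let h : ℕ → ℂ := fun n => d n * (1 - (-1) ^ n) * ∑ k ∈ Finset.range 5, z ^ (k * (n + 1))
  have hh : ∀ q : ℂ, ‖q‖ < 1 → HasSum (fun n => h n * q ^ n) 0 := by
    intro q hq
    have hnk : ∀ k : ℕ, ‖z ^ k * q‖ < 1 := by
      intro k; rw [norm_mul, norm_pow, hzn, one_pow, one_mul]; exact hq
    have hs : HasSum (fun n => ∑ k ∈ Finset.range 5, z ^ k * (d n * (z ^ k * q) ^ n -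
        d n * (-(z ^ k * q)) ^ n))
        (∑ k ∈ Finset.range 5, z ^ k * (D (z ^ k * q) - D (-(z ^ k * q)))) :=
      hasSum_sum fun k _ => ((hD _ (hnk k)).sub (hD _ (by simpa using hnk k))).mul_left _
    have hval : ∑ k ∈ Finset.range 5, z ^ k * (D (z ^ k * q) - D (-(z ^ k * q))) = 0 := by
      by_cases hq0 : q = 0
      · simp [hq0]
      · have e : ∀ k ∈ Finset.range 5, z ^ k * (D (z ^ k * q) - D (-(z ^ k * q))) =
            (1 / 5) * (z ^ k * GG (z ^ k * q)) - (1 / 5) * (z ^ k * GG (z ^ k * -q)) := by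
          intro k _
          have hk0 : z ^ k * q ≠ 0 := mul_ne_zero (pow_ne_zero _ hz0) hq0
          have r1 := F_rel hk0 (hnk k)
          have r2 := F_rel (neg_ne_zero.2 hk0) (by simpa using hnk k)
          rw [neg_sq] at r2
          rw [mul_neg]
          simp only [D]
          linear_combination (z ^ k / 5) * r1 - (z ^ k / 5) * r2
        rw [Finset.sum_congr rfl e, Finset.sum_sub_distrib, ← Finset.mul_sum, ← Finset.mul_sum,
          GG_sum hq0 hq hz, GG_sum (neg_ne_zero.2 hq0) (by simpa using hq) hz]
        simp
    rw [hval] at hs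
    convert hs using 2 with n
    simp only [h]
    rw [Finset.mul_sum, Finset.sum_mul]
    refine Finset.sum_congr rfl fun k _ => ?_
    rw [neg_pow (z ^ k * q)]
    ring
  have hfin := coeff_zero_of_hasSum h hh
  intro n
  have hn := hfin (10 * n + 9)
  have hzs : ∑ k ∈ Finset.range 5, z ^ (k * (10 * n + 9 + 1)) = 5 := by
    have : ∀ k ∈ Finset.range 5, z ^ (k * (10 * n + 9 + 1)) = 1 := by
      intro k _
      rw [show k * (10 * n + 9 + 1) = 5 * (k * (2 * n + 2)) by ring, pow_mul, h5, one_pow]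
    rw [Finset.sum_congr rfl this]
    simp
  have hodd : ((-1 : ℂ)) ^ (10 * n + 9) = -1 := Odd.neg_one_pow ⟨5 * n + 4, by ring⟩
  simp only [h, hzs, hodd, d, c'] at hn
  have hn' : (a (10 * n + 9) : ℂ) - 2 * (c (10 * n + 8) : ℂ) = 0 := by
    rw [if_neg (by omega), show 10 * n + 9 - 1 = 10 * n + 8 by omega] at hn
    linear_combination hn / 10
  have : (a (10 * n + 9) : ℂ) = ((2 * c (10 * n + 8) : ℤ) : ℂ) := by
    push_cast
    linear_combination hn'
  exact_mod_cast this
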